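/- Let 0 < r < r', c, c' ∈ ℝ² with c'.y < c.y and with c, c' in general position. Let q ∈ T(c,r) with ‖q − c'‖ > r', and let θ_I ∈ [−π/3, π/3] be the unique angle with (γ_{c,r}(θ_I)).y = q.y. Then γ_{c,r}(θ_I) ∉ T(c',r'), and for all θ₁, θ₂ ∈ [−π/3, π/3] with θ_I ≤ θ₂ < θ₁, if γ_{c,r}(θ₂) ∈ T(c',r') then γ_{c,r}(θ₁) ∈ T(c',r'). That is, θ_I lies in the highest connected component of the set {θ ∈ [−π/3, π/3] : γ_{c,r}(θ) ∉ T(c',r')}. -/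

import Mathlib

open Real

/-- The Euclidean norm of a point of the plane `ℝ × ℝ`. -/
noncomputable def ptNorm (p : ℝ × ℝ) : ℝ := Real.sqrt (p.1 ^ 2 + p.2 ^ 2)

/-- The parametrization of the right arc: `γ c r θ = c + r·(cos θ, sin θ)`. -/
noncomputable def gam (c : ℝ × ℝ) (r θ : ℝ) : ℝ × ℝ :=
  (c.1 + r * Real.cos θ, c.2 + r * Real.sin θ)

/-- The right portion `T(c,r)`: the closed circular sector
`{c + ρ·(cos θ, sin θ) : 0 ≤ ρ ≤ r, −π/3 ≤ θ ≤ π/3}`. -/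
def Sector (c : ℝ × ℝ) (r : ℝ) : Set (ℝ × ℝ) :=
  {p | ∃ ρ θ : ℝ, 0 ≤ ρ ∧ ρ ≤ r ∧ -(π / 3) ≤ θ ∧ θ ≤ π / 3 ∧
    p = (c.1 + ρ * Real.cos θ, c.2 + ρ * Real.sin θ)}

/-- The right arc `A(c,r)`: the image of `γ c r` on `[−π/3, π/3]`. -/
def Arc (c : ℝ × ℝ) (r : ℝ) : Set (ℝ × ℝ) :=
  {p | ∃ θ : ℝ, -(π / 3) ≤ θ ∧ θ ≤ π / 3 ∧ p = gam c r θ}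

/-- General position of two centers: `c' − c` is not a scalar multiple of
`(cos(π/3), sin(π/3))` nor of `(cos(π/3), −sin(π/3))`. -/
def GenPos (c c' : ℝ × ℝ) : Prop :=
  (∀ t : ℝ, c' - c ≠ t • ((Real.cos (π / 3), Real.sin (π / 3)) : ℝ × ℝ)) ∧
  (∀ t : ℝ, c' - c ≠ t • ((Real.cos (π / 3), -Real.sin (π / 3)) : ℝ × ℝ))

theorem sec_trig {θ : ℝ} (h1 : -(π / 3) ≤ θ) (h2 : θ ≤ π / 3) :
    1 / 2 ≤ cos θ ∧ sin θ ≤ √3 * (1 / 2) ∧ -(√3 * (1 / 2)) ≤ sin θ := by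
  have hp := Real.pi_pos
  refine ⟨?_, ?_, ?_⟩
  · rw [← Real.cos_pi_div_three, ← Real.cos_abs θ]
    exact Real.cos_le_cos_of_nonneg_of_le_pi (abs_nonneg _) (by linarith) (abs_le.2 ⟨h1, h2⟩)
  · have := Real.sin_le_sin_of_le_of_le_pi_div_two (x := θ) (y := π / 3)
      (by linarith) (by linarith) h2
    rw [Real.sin_pi_div_three] at this
    linarith
  · have := Real.sin_le_sin_of_le_of_le_pi_div_two (x := -(π / 3)) (y := θ)
      (by linarith) (by linarith) h1
    rw [Real.sin_neg, Real.sin_pi_div_three] at this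
    linarith

theorem sec_fwd {c : ℝ × ℝ} {r : ℝ} {p : ℝ × ℝ} (h : p ∈ Sector c r) :
    (p.1 - c.1) ^ 2 + (p.2 - c.2) ^ 2 ≤ r ^ 2 ∧ p.2 - c.2 ≤ √3 * (p.1 - c.1) ∧
      -(p.2 - c.2) ≤ √3 * (p.1 - c.1) := by
  obtain ⟨ρ, θ, h0, h1, h2, h3, rfl⟩ := h
  obtain ⟨hc, hs, hs'⟩ := sec_trig h2 h3
  have e := Real.sin_sq_add_cos_sq θ
  have hk : 0 ≤ √3 := Real.sqrt_nonneg 3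
  have hm : √3 * (1 / 2) ≤ √3 * cos θ := mul_le_mul_of_nonneg_left hc hk
  simp only [add_sub_cancel_left]
  refine ⟨?_, ?_, ?_⟩
  · have : (ρ * cos θ) ^ 2 + (ρ * sin θ) ^ 2 = ρ ^ 2 := by linear_combination ρ ^ 2 * e
    rw [this]
    exact pow_le_pow_left₀ h0 h1 2
  · have := mul_le_mul_of_nonneg_left (hs.trans hm) h0
    linarith
  · have := mul_le_mul_of_nonneg_left ((neg_le.1 hs').trans hm) h0
    linarith

theorem sec_bwd {c : ℝ × ℝ} {r : ℝ} {p : ℝ × ℝ} (hr : 0 ≤ r)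
    (h1 : (p.1 - c.1) ^ 2 + (p.2 - c.2) ^ 2 ≤ r ^ 2) (h2 : p.2 - c.2 ≤ √3 * (p.1 - c.1))
    (h3 : -(p.2 - c.2) ≤ √3 * (p.1 - c.1)) : p ∈ Sector c r := by
  obtain ⟨px, py⟩ := p
  obtain ⟨cx, cy⟩ := c
  simp only at h1 h2 h3
  obtain ⟨x, rfl⟩ : ∃ x, px = cx + x := ⟨px - cx, by ring⟩
  obtain ⟨y, rfl⟩ : ∃ y, py = cy + y := ⟨py - cy, by ring⟩
  simp only [add_sub_cancel_left] at h1 h2 h3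
  have hk : 0 < √3 := by positivity
  have hk2 : √3 ^ 2 = 3 := Real.sq_sqrt (by norm_num)
  have hx : 0 ≤ x := by
    by_contra hx
    push Not at hx
    nlinarith
  have hy2 : y ^ 2 ≤ 3 * x ^ 2 := by
    have := sq_le_sq' (by linarith) h2
    nlinarith
  have hp := Real.pi_pos
  rcases eq_or_lt_of_le hx with h0 | h0
  · have hy0 : y = 0 := by
      have : y ^ 2 ≤ 0 := by rw [← h0] at hy2; simpa using hy2
      nlinarith
    exact ⟨0, 0, le_rfl, hr, by linarith, by linarith, by simp [← h0, hy0]⟩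
  · have hd : 0 < x ^ 2 + y ^ 2 := by positivity
    set ρ := √(x ^ 2 + y ^ 2) with hρ
    have hρ0 : 0 < ρ := Real.sqrt_pos.2 hd
    have hρ2 : ρ ^ 2 = x ^ 2 + y ^ 2 := Real.sq_sqrt hd.le
    have hb : |y / ρ| ≤ √3 / 2 := by
      apply abs_le_of_sq_le_sq _ (by positivity)
      rw [div_pow, div_pow, hk2, hρ2, div_le_div_iff₀ hd (by norm_num)]
      nlinarith
    obtain ⟨hb1, hb2⟩ := abs_le.1 hb
    have hl1 : √3 / 2 ≤ 1 := by nlinarith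
    have ha : arcsin (√3 / 2) = π / 3 := by
      rw [← Real.sin_pi_div_three]
      exact Real.arcsin_sin (by linarith) (by linarith)
    refine ⟨ρ, arcsin (y / ρ), hρ0.le, ?_, ?_, ?_, ?_⟩
    · exact (Real.sqrt_le_left hr).2 h1
    · rw [← ha, ← Real.arcsin_neg]
      exact Real.monotone_arcsin hb1
    · rw [← ha]
      exact Real.monotone_arcsin hb2
    · rw [Real.cos_arcsin, Real.sin_arcsin (by linarith) (by linarith)]
      have : 1 - (y / ρ) ^ 2 = (x / ρ) ^ 2 := by
        field_simp
        linarith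
      rw [this, Real.sqrt_sq (by positivity)]
      ext
      · simp only; field_simp
      · simp only; field_simp

theorem alg_part1 {k r r' a h X qx : ℝ} (hk : 0 < k) (hk2 : k ^ 2 = 3)
    (hr : 0 < r) (hrr : r < r') (hX : X ≤ r) (hq0 : 0 ≤ qx) (hqX : qx ≤ X)
    (hq : r' ^ 2 < (qx - a) ^ 2 + h ^ 2) (h1 : (X - a) ^ 2 + h ^ 2 ≤ r' ^ 2)
    (h2 : h ≤ k * (X - a)) (h3 : -h ≤ k * (X - a)) : False := by
  have hh : h ^ 2 ≤ 3 * (X - a) ^ 2 := by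
    have := sq_le_sq' (by linarith) h2
    nlinarith
  obtain ⟨u, hu⟩ : ∃ u, u = X - a := ⟨_, rfl⟩
  obtain ⟨D, hD⟩ : ∃ D, D = X - qx := ⟨_, rfl⟩
  have e : qx - a = u - D := by rw [hu, hD]; ring
  rw [e] at hq
  rw [← hu] at h1 hh
  have hD0 : 0 ≤ D := by linarith
  have hDr : D ^ 2 ≤ r' ^ 2 := pow_le_pow_left₀ hD0 (by linarith) 2
  have g1 : 0 < u * (2 * u - D) := by nlinarith
  have g2 : 0 < D * (D - 2 * u) := by nlinarith
  have g3 : 0 < D - 2 * u := pos_of_mul_pos_right g2 hD0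
  have hu0 : 0 ≤ u := by
    have : 0 ≤ k * u := by rw [hu]; linarith
    exact nonneg_of_mul_nonneg_right this hk
  have g4 : 0 < 2 * u - D := pos_of_mul_pos_right g1 hu0
  linarith

/-- Hitting point inside the large disk: no higher arc point lies in the large sector. -/
theorem alg_caseB {k r r' a b X y qx x2 y2 : ℝ} (hk : 0 < k) (hk2 : k ^ 2 = 3)
    (hr : 0 < r) (hrr : r < r') (hb : 0 < b)
    (hc : X ^ 2 + y ^ 2 = r ^ 2) (hX : r / 2 ≤ X) (hq0 : 0 ≤ qx) (hqX : qx ≤ X)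
    (hqy : -y ≤ k * qx)
    (hq : r' ^ 2 < (qx - a) ^ 2 + (y + b) ^ 2) (h1 : (X - a) ^ 2 + (y + b) ^ 2 ≤ r' ^ 2)
    (hc2 : x2 ^ 2 + y2 ^ 2 = r ^ 2) (hX2 : r / 2 ≤ x2) (hy2 : y ≤ y2)
    (g2 : y2 + b ≤ k * (x2 - a)) (g3 : -(y2 + b) ≤ k * (x2 - a)) : False := by
  have hXr : X ≤ r := by nlinarith
  have hx2r : x2 ≤ r := by nlinarith
  have hr2 : r ^ 2 < r' ^ 2 := by nlinarith
  have ha2 : a ≤ x2 := by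
    by_contra hn
    push Not at hn
    nlinarith
  have hlt : (X - a) ^ 2 < (qx - a) ^ 2 := by linarith
  have hqa : X + qx < 2 * a := by
    by_contra hn
    push Not at hn
    nlinarith [mul_nonneg (sub_nonneg.2 hqX) (sub_nonneg.2 hn)]
  rcases le_or_gt 0 y with hy | hy
  · have hx : x2 ≤ X := by
      by_contra hn
      push Not at hn
      nlinarith
    have := mul_le_mul_of_nonneg_left (sub_le_sub_right hx a) hk.le
    exact alg_part1 hk hk2 hr hrr hXr hq0 hqX hq h1 (by linarith) (by linarith)
  · obtain ⟨m, hm⟩ : ∃ m, y = -(k * m) := ⟨-y / k, by field_simp⟩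
    subst hm
    have hm0 : 0 < m := by
      by_contra hn
      push Not at hn
      nlinarith
    have hmq : m ≤ qx := by
      have : k * m ≤ k * qx := by linarith
      exact le_of_mul_le_mul_left this hk
    have hc' : X ^ 2 + 3 * m ^ 2 = r ^ 2 := by rw [← hk2]; linarith
    have hmr : m ≤ r / 2 := by nlinarith
    have hXm : r ≤ X + m := by
      by_contra hn
      push Not at hn
      nlinarith
    have ha : r / 2 ≤ a := by linarith
    rcases le_or_gt 0 (-(k * m) + b) with hh | hh
    · have hle : -(k * m) + b ≤ k * (r - a) := by
        have := mul_le_mul_of_nonneg_left (sub_le_sub_right hx2r a) hk.le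
        linarith
      have : (-(k * m) + b) ^ 2 ≤ 3 * (r - a) ^ 2 := by
        have := pow_le_pow_left₀ hh hle 2
        rwa [mul_pow, hk2] at this
      have t1 : 0 ≤ qx * (2 * a - qx) := mul_nonneg hq0 (by linarith)
      have t2 : 0 ≤ (r - a) * (2 * a - r) := mul_nonneg (by linarith) (by linarith)
      linarith
    · have : (-(k * m) + b) ^ 2 ≤ 3 * m ^ 2 := by
        rw [← hk2, ← mul_pow]
        exact sq_le_sq' (by linarith) (by linarith)
      have : (qx - a) ^ 2 ≤ (r - m) ^ 2 := by
        have : 0 ≤ a - qx := by linarith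
        have : a - qx ≤ r - m := by linarith
        exact sq_le_sq' (by linarith) (by linarith)
      have t : 0 ≤ m * (r - 2 * m) := mul_nonneg hm0.le (by linarith)
      linarith

set_option maxHeartbeats 1000000 in
/-- Hitting point outside the large disk. -/
theorem alg_caseA {k r r' a b x0 y0 x1 y1 x2 y2 : ℝ} (hk : 0 < k)
    (hr : 0 < r) (hrr : r < r') (hb : 0 < b)
    (hc0 : x0 ^ 2 + y0 ^ 2 = r ^ 2) (hX0 : r / 2 ≤ x0) (hk0 : y0 ≤ k * x0)
    (hc1 : x1 ^ 2 + y1 ^ 2 = r ^ 2) (hX1 : r / 2 ≤ x1) (hk1 : y1 ≤ k * x1)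
    (hc2 : x2 ^ 2 + y2 ^ 2 = r ^ 2) (hX2 : r / 2 ≤ x2) (hk2 : y2 ≤ k * x2)
    (h02 : y0 ≤ y2) (h21 : y2 < y1)
    (h0 : r' ^ 2 < (x0 - a) ^ 2 + (y0 + b) ^ 2) (h2 : (x2 - a) ^ 2 + (y2 + b) ^ 2 ≤ r' ^ 2)
    (g2 : y2 + b ≤ k * (x2 - a)) (g3 : -(y2 + b) ≤ k * (x2 - a)) :
    (x1 - a) ^ 2 + (y1 + b) ^ 2 ≤ r' ^ 2 ∧ y1 + b ≤ k * (x1 - a) ∧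
      -(y1 + b) ≤ k * (x1 - a) := by
  have hr2 : r ^ 2 < r' ^ 2 := by nlinarith
  have ha2 : a ≤ x2 := by
    by_contra hn
    push Not at hn
    nlinarith
  have hx2r : x2 ≤ r := by nlinarith
  have key : b * (y2 - y0) < a * (x2 - x0) := by nlinarith
  have hy02 : y0 < y2 := by
    rcases eq_or_lt_of_le h02 with h | h
    · exfalso
      have : x0 = x2 := by
        have : (x0 - x2) * (x0 + x2) = 0 := by rw [h] at hc0; linarith
        rcases mul_eq_zero.1 this with h | h <;> linarith
      rw [h, this] at key
      simp at key
    · exact h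
  have hpos : 0 < a * (x2 - x0) := lt_trans (mul_pos hb (by linarith)) key
  have key2 : b * (x2 + x0) < a * (-y0 - y2) := by
    have e : (a * (x2 - x0)) * (x2 + x0) = (a * (-y0 - y2)) * (y2 - y0) := by
      linear_combination a * (hc2 - hc0)
    have := mul_lt_mul_of_pos_right key (show 0 < x2 + x0 by linarith)
    rw [e] at this
    have : (b * (x2 + x0)) * (y2 - y0) < (a * (-y0 - y2)) * (y2 - y0) := by linarith
    exact lt_of_mul_lt_mul_right this (by linarith)
  rcases lt_or_ge 0 a with ha | ha
  · exfalso
    have hx : x0 < x2 := by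
      have := pos_of_mul_pos_right hpos ha.le
      linarith
    have hw : b * x0 ≤ a * (-y0) := by nlinarith
    have hw0 : 0 < -y0 := by
      have : 0 < b * x0 := mul_pos hb (by linarith)
      exact pos_of_mul_pos_right (lt_of_lt_of_le this hw) ha.le
    have hb2 : b ≤ 2 * (-y0) := by
      have : b * x0 ≤ (2 * (-y0)) * x0 := by
        have := mul_nonneg hw0.le (show 0 ≤ 2 * x0 - a by linarith)
        linarith
      exact le_of_mul_le_mul_right this (by linarith)
    have t1 : 0 ≤ a * (2 * x0 - a) := mul_nonneg ha.le (by linarith)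
    have t2 : 0 ≤ b * (2 * (-y0) - b) := mul_nonneg hb.le (by linarith)
    linarith
  · have hx : x2 < x0 := by
      by_contra hn
      push Not at hn
      nlinarith
    have hsum : 0 < y0 + y2 := by
      by_contra hn
      push Not at hn
      nlinarith
    have hy2 : 0 < y2 := by linarith
    have hx1 : x1 < x2 := by
      by_contra hn
      push Not at hn
      nlinarith
    have hna : 0 ≤ -a := by linarith
    have hbk : b ≤ -a * k := by
      have : -a * (y0 + y2) ≤ -a * (k * (x2 + x0)) := mul_le_mul_of_nonneg_left (by linarith) hna
      have : b * (x2 + x0) ≤ (-a * k) * (x2 + x0) := by linarith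
      exact le_of_mul_le_mul_right this (by linarith)
    refine ⟨?_, by linarith, ?_⟩
    · have s1 : -a * (y0 + y2) ≤ -a * (y1 + y2) := mul_le_mul_of_nonneg_left (by linarith) hna
      have s2 : b * (x1 + x2) ≤ b * (x2 + x0) := mul_le_mul_of_nonneg_left (by linarith) hb.le
      have s3 : b * (x1 + x2) ≤ -a * (y1 + y2) := by linarith
      have s4 := mul_le_mul_of_nonneg_right s3 (show 0 ≤ y1 - y2 by linarith)
      have e : (-a * (y1 + y2)) * (y1 - y2) = (-a * (x2 - x1)) * (x1 + x2) := by
        linear_combination -a * (hc1 - hc2)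
      have s5 : b * (y1 - y2) ≤ -a * (x2 - x1) := by
        have : (b * (y1 - y2)) * (x1 + x2) ≤ (-a * (x2 - x1)) * (x1 + x2) := by linarith
        exact le_of_mul_le_mul_right this (by linarith)
      linarith
    · have : 0 ≤ k * (x1 - a) := mul_nonneg hk.le (by linarith)
      linarith

theorem arc_alg {r θ : ℝ} (hr : 0 < r) (h : θ ∈ Set.Icc (-(π / 3)) (π / 3)) :
    (r * cos θ) ^ 2 + (r * sin θ) ^ 2 = r ^ 2 ∧ r / 2 ≤ r * cos θ ∧
      r * sin θ ≤ √3 * (r * cos θ) := by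
  obtain ⟨hc, hs, hs'⟩ := sec_trig h.1 h.2
  have hm : √3 * (1 / 2) ≤ √3 * cos θ := mul_le_mul_of_nonneg_left hc (Real.sqrt_nonneg 3)
  refine ⟨by linear_combination r ^ 2 * Real.sin_sq_add_cos_sq θ, by nlinarith, ?_⟩
  have := mul_le_mul_of_nonneg_left (hs.trans hm) hr.le
  linarith

/-- If the center of the larger disk lies below that of the smaller one,
and `q ∈ T(c,r)` lies outside the larger disk, then the angle `θ_I` of the point
where the rightward ray from `q` hits `A(c,r)` lies in the highest connected component
of `{θ ∈ [−π/3, π/3] : γ_{c,r}(θ) ∉ T(c',r')}`. -/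
theorem hit_angle_in_highest_component (c c' : ℝ × ℝ) (r r' : ℝ)
    (hr : 0 < r) (hrr' : r < r') (hy : c'.2 < c.2) (hgp : GenPos c c')
    (q : ℝ × ℝ) (hq : q ∈ Sector c r) (hq' : r' < ptNorm (q - c'))
    (θI : ℝ) (hθI : θI ∈ Set.Icc (-(π / 3)) (π / 3)) (hy' : (gam c r θI).2 = q.2) :
    gam c r θI ∉ Sector c' r' ∧
    ∀ θ₁ θ₂ : ℝ, θ₁ ∈ Set.Icc (-(π / 3)) (π / 3) → θ₂ ∈ Set.Icc (-(π / 3)) (π / 3) →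
      θI ≤ θ₂ → θ₂ < θ₁ → gam c r θ₂ ∈ Sector c' r' → gam c r θ₁ ∈ Sector c' r' := by
  have hk : 0 < √3 := by positivity
  have hk2 : √3 ^ 2 = 3 := Real.sq_sqrt (by norm_num)
  have hp := Real.pi_pos
  have hr' : 0 < r' := hr.trans hrr'
  obtain ⟨hc0, hX0, hk0⟩ := arc_alg hr hθI
  obtain ⟨q1, q2, q3⟩ := sec_fwd hq
  have hb : 0 < c.2 - c'.2 := by linarith
  have hyq : q.2 - c.2 = r * sin θI := by
    simp only [gam] at hy'
    linarith
  have hq0 : 0 ≤ q.1 - c.1 := by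
    by_contra hn
    push Not at hn
    nlinarith
  have hqX : q.1 - c.1 ≤ r * cos θI := by
    rw [hyq] at q1
    exact le_of_sq_le_sq (by linarith) (by linarith)
  have hXr : r * cos θI ≤ r := by nlinarith
  have hqd : r' ^ 2 < ((q.1 - c.1) - (c'.1 - c.1)) ^ 2 + (r * sin θI + (c.2 - c'.2)) ^ 2 := by
    have := (Real.lt_sqrt hr'.le).1 hq'
    rw [← hyq]
    simp only [Prod.fst_sub, Prod.snd_sub] at this
    linarith
  have ex : ∀ θ, (gam c r θ).1 - c'.1 = r * cos θ - (c'.1 - c.1) := fun θ => by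
    simp only [gam]; ring
  have ey : ∀ θ, (gam c r θ).2 - c'.2 = r * sin θ + (c.2 - c'.2) := fun θ => by
    simp only [gam]; ring
  refine ⟨fun hI => ?_, fun θ₁ θ₂ h1 h2 h02 h21 hP2 => ?_⟩
  · obtain ⟨a1, a2, a3⟩ := sec_fwd hI
    rw [ex, ey] at a1 a2 a3
    exact alg_part1 hk hk2 hr hrr' hXr hq0 hqX hqd a1 a2 a3
  · obtain ⟨a1, a2, a3⟩ := sec_fwd hP2
    rw [ex, ey] at a1 a2 a3
    obtain ⟨hc1, hX1, hk1⟩ := arc_alg hr h1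
    obtain ⟨hc2, hX2, hk2'⟩ := arc_alg hr h2
    have l02 : r * sin θI ≤ r * sin θ₂ := by
      have := Real.sin_le_sin_of_le_of_le_pi_div_two (x := θI) (y := θ₂)
        (by linarith [hθI.1]) (by linarith [h2.2]) h02
      exact mul_le_mul_of_nonneg_left this hr.le
    have l21 : r * sin θ₂ < r * sin θ₁ := by
      have := Real.sin_lt_sin_of_lt_of_le_pi_div_two (x := θ₂) (y := θ₁)
        (by linarith [h2.1]) (by linarith [h1.2]) h21
      exact mul_lt_mul_of_pos_left this hr
    rcases le_or_gt ((r * cos θI - (c'.1 - c.1)) ^ 2 + (r * sin θI + (c.2 - c'.2)) ^ 2)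
      (r' ^ 2) with hd | hd
    · exact (alg_caseB hk hk2 hr hrr' hb hc0 hX0 hq0 hqX (by rw [← hyq]; exact q3) hqd hd
        hc2 hX2 l02 a2 a3).elim
    · obtain ⟨b1, b2, b3⟩ := alg_caseA hk hr hrr' hb hc0 hX0 hk0 hc1 hX1 hk1 hc2 hX2 hk2'
        l02 l21 hd a1 a2 a3
      apply sec_bwd hr'.le <;> rw [ex, ey] <;> assumption
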